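/- arXiv:1703.08039 — 2 statements merged into one kernel-verified Lean document; each statement's English description precedes it below -/
import Mathlib

section
/- If n > 2 is a prime number and 2n is a G number, then k1 = g((n-1)^2, p1(n)) / p1(n) equals n (so k1 = p1(n) = n and both summands in 2n = p1(n) + k1 are prime). -/
/-- `g x m = x + 2m - ((x - m) mod 2m)`. -/
def g (x m : ℕ) : ℕ := x + 2 * m - (x - m) % (2 * m)

/-- `p1 n` is the maximum of the smallest prime factor of `g ((n-1)^2) p`
taken over all odd primes `p ≤ n`. -/
def p1 (n : ℕ) : ℕ :=
  ((Finset.range (n + 1)).filter (fun p => p.Prime ∧ Odd p)).sup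
    (fun p => Nat.minFac (g ((n - 1) ^ 2) p))

/-- The even number `2n` is a G number if `g ((n-1)^2) (p1 n) = p1 n * (2n - p1 n)`. -/
def IsGNumber (n : ℕ) : Prop :=
  g ((n - 1) ^ 2) (p1 n) = p1 n * (2 * n - p1 n)

theorem g_dvd_aux (x p : ℕ) (h : p ≤ x) : p ∣ g x p := by
  obtain ⟨t, rfl⟩ := Nat.exists_eq_add_of_le h
  refine ⟨3 + 2 * (t / (2 * p)), ?_⟩
  unfold g
  have e : p + t - p = t := by omega
  rw [e]
  have h1 := Nat.mod_add_div t (2 * p)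
  have h2 : p * (3 + 2 * (t / (2 * p))) = 3 * p + 2 * p * (t / (2 * p)) := by ring
  rw [h2]
  omega

theorem g_self_aux (n : ℕ) (hn : 2 < n) (ho : Odd n) : g ((n - 1) ^ 2) n = n ^ 2 := by
  obtain ⟨k, rfl⟩ := ho
  obtain ⟨j, rfl⟩ : ∃ j, k = j + 1 := ⟨k - 1, by omega⟩
  unfold g
  have e0 : 2 * (j + 1) + 1 - 1 = 2 * j + 2 := by omega
  have e1 : (2 * j + 2) ^ 2 - (2 * (j + 1) + 1) = 1 + 2 * (2 * (j + 1) + 1) * j := by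
    apply Nat.sub_eq_of_eq_add
    ring
  rw [e0, e1, Nat.add_mul_mod_self_left, Nat.mod_eq_of_lt (by omega)]
  apply Nat.sub_eq_of_eq_add
  ring

theorem p1_prime_aux (n : ℕ) (hn : 2 < n) (hp : Nat.Prime n) : p1 n = n := by
  have ho : Odd n := hp.odd_of_ne_two (by omega)
  unfold p1
  apply le_antisymm
  · apply Finset.sup_le
    intro p hpm
    simp only [Finset.mem_filter, Finset.mem_range] at hpm
    obtain ⟨h1, h2, h3⟩ := hpm
    have hx : p ≤ (n - 1) ^ 2 := by
      obtain ⟨m, rfl⟩ : ∃ m, n = m + 3 := ⟨n - 3, by omega⟩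
      have : m + 3 - 1 = m + 2 := by omega
      rw [this]
      nlinarith
    exact (Nat.minFac_le_of_dvd h2.two_le (g_dvd_aux _ _ hx)).trans (by omega)
  · have hm : n ∈ (Finset.range (n + 1)).filter (fun p => p.Prime ∧ Odd p) := by
      simp [hp, ho]
    have := Finset.le_sup (f := fun p => Nat.minFac (g ((n - 1) ^ 2) p)) hm
    simp only [g_self_aux n hn ho] at this
    rwa [Nat.pow_minFac (by norm_num), hp.minFac_eq] at this

theorem stmt_11 (n : ℕ) (hn : 2 < n) (hp : Nat.Prime n) (hG : IsGNumber n) :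
    g ((n - 1) ^ 2) (p1 n) / p1 n = n ∧ p1 n = n ∧
      2 * n = p1 n + g ((n - 1) ^ 2) (p1 n) / p1 n ∧
      Nat.Prime (p1 n) ∧ Nat.Prime (g ((n - 1) ^ 2) (p1 n) / p1 n) := by
  have h1 := p1_prime_aux n hn hp
  have h2 : g ((n - 1) ^ 2) n / n = n := by
    rw [g_self_aux n hn (hp.odd_of_ne_two (by omega)), pow_two,
      Nat.mul_div_cancel _ (by omega)]
  rw [h1, h2]
  exact ⟨rfl, rfl, by omega, hp, hp⟩
end

section
/- If n > 7 is an integer and 2n is a G number, then 2n - p1(n) is a prime number. -/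
theorem g_spec (x m : ℕ) (hm : Odd m) (h : m ≤ x) :
    m ∣ g x m ∧ Odd (g x m) ∧ x < g x m ∧ g x m ≤ x + 2 * m := by
  have hm0 : 0 < m := hm.pos
  have h1 := Nat.mod_add_div (x - m) (2 * m)
  have h2 := Nat.mod_lt (x - m) (show 0 < 2 * m by omega)
  have h3 : g x m = m * (2 * ((x - m) / (2 * m)) + 3) := by
    unfold g
    have : m * (2 * ((x - m) / (2 * m)) + 3) = 2 * m * ((x - m) / (2 * m)) + 3 * m := by ring
    omega
  refine ⟨⟨_, h3⟩, ?_, ?_, ?_⟩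
  · rw [h3]
    exact hm.mul ⟨(x - m) / (2 * m) + 1, by ring⟩
  · unfold g; omega
  · unfold g; omega

theorem stmt_16 (n : ℕ) (hn : 7 < n) (hG : IsGNumber n) :
    Nat.Prime (2 * n - p1 n) := by
  have hne : ((Finset.range (n + 1)).filter (fun p => p.Prime ∧ Odd p)).Nonempty :=
    ⟨3, by simp only [Finset.mem_filter, Finset.mem_range]; exact ⟨by omega, by norm_num, by decide⟩⟩
  obtain ⟨p, hp, hpe⟩ := Finset.exists_mem_eq_sup _ hne (fun p => Nat.minFac (g ((n - 1) ^ 2) p))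
  change p1 n = Nat.minFac (g ((n - 1) ^ 2) p) at hpe
  simp only [Finset.mem_filter, Finset.mem_range] at hp
  obtain ⟨hpn, hpp, hpo⟩ := hp
  unfold IsGNumber at hG
  generalize p1 n = P at *
  obtain ⟨k, rfl⟩ : ∃ k, n = k + 1 := ⟨n - 1, by omega⟩
  simp only [Nat.add_sub_cancel] at *
  have hkx : k + 1 ≤ k ^ 2 := by nlinarith
  obtain ⟨a1, a2, a3, a4⟩ := g_spec (k ^ 2) p hpo (by omega)
  have hg1 : g (k ^ 2) p ≠ 1 := by omega
  have hP : P.Prime := hpe ▸ Nat.minFac_prime hg1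
  have hPd : P ∣ g (k ^ 2) p := hpe ▸ Nat.minFac_dvd _
  have hPo : Odd P := a2.of_dvd_nat hPd
  have hPp : P ≤ p := hpe ▸ Nat.minFac_le_of_dvd hpp.two_le a1
  obtain ⟨b1, b2, b3, b4⟩ := g_spec (k ^ 2) P hPo (by omega)
  obtain ⟨s, hs⟩ : ∃ s, 2 * (k + 1) = P + s := ⟨2 * (k + 1) - P, by omega⟩
  have hs' : 2 * (k + 1) - P = s := by omega
  rw [hs'] at hG ⊢
  rw [hG] at b2 b3 b4
  have h2P : k + 1 < 2 * P := by
    by_contra hc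
    obtain ⟨d, hd⟩ : ∃ d, k + 1 = 2 * P + d := ⟨k + 1 - 2 * P, by omega⟩
    have : s = 3 * P + 2 * d := by omega
    subst this
    obtain rfl : k = 2 * P + d - 1 := by omega
    have h1 : 1 ≤ 2 * P + d := by omega
    zify [h1] at *
    nlinarith
  have hso : Odd s := (Nat.odd_mul.1 b2).2
  have hP5 : 5 ≤ P := by omega
  have hmin : ∀ q : ℕ, q.Prime → q ∣ g (k ^ 2) p → P ≤ q := fun q hq hd =>
    hpe ▸ Nat.minFac_le_of_dvd hq.two_le hd
  rcases hPp.eq_or_lt with rfl | hlt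
  · by_contra hsp
    have hs1 : s ≠ 1 := by omega
    have := hmin _ (Nat.minFac_prime hs1) ((Nat.minFac_dvd s).trans (hG ▸ Dvd.intro_left _ rfl))
    have h3 := Nat.minFac_sq_le_self (by omega) hsp
    nlinarith
  · exfalso
    obtain ⟨t, ht⟩ := Nat.Coprime.mul_dvd_of_dvd_of_dvd
      ((Nat.coprime_primes hP hpp).2 hlt.ne) hPd a1
    have ht1 : t = 1 := by
      by_contra ht1
      have h1 := hmin _ (Nat.minFac_prime ht1) ((Nat.minFac_dvd t).trans (ht ▸ Dvd.intro_left _ rfl))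
      have ht0 : 0 < t := by
        rcases Nat.eq_zero_or_pos t with h | h
        · subst h; omega
        · exact h
      have h2 := Nat.minFac_le ht0
      have h3 : P * p * P ≤ P * p * t := Nat.mul_le_mul_left _ (h1.trans h2)
      have h4 : P * (P + 1) * P ≤ P * p * P := by gcongr; omega
      have h5 : P * (P + 1) * P ≤ k ^ 2 + 2 * (k + 1) := by omega
      have h6 : k + 2 ≤ 2 * P := by omega
      have h7 : (k + 2) ^ 2 ≤ (2 * P) ^ 2 := by gcongr
      nlinarith
    subst ht1
    obtain ⟨u, hu⟩ := hso
    obtain ⟨v, hv⟩ := hpo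
    have h1 : p + 2 ≤ s := by omega
    have h2 : P * (p + 2) ≤ P * s := Nat.mul_le_mul_left _ h1
    rw [ht] at a3
    nlinarith
end
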